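/- arXiv:1607.06956 — 2 statements merged into one kernel-verified Lean document; each statement's English description precedes it below -/
import Mathlib

section
/- Let u, q : ℝ × ℝ → ℝ be smooth functions, 2π-periodic in the first (spatial) variable, satisfying ∂ₜu = ∂ₓₓu + ∂ₓ(u·q) and ∂ₜq = u·∂ₓu. Then for every t ∈ ℝ the function t ↦ (1/2)∫₀^{2π} ((∂ₓu(x,t))² + (∂ₓq(x,t))²) dx has derivative at t equal to −∫₀^{2π} (∂ₓₓu(x,t))² dx + (3/2)∫₀^{2π} ∂ₓq(x,t)·(∂ₓu(x,t))² dx. -/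
open intervalIntegral Real

/-- Partial derivative in the first (spatial) variable of a function on ℝ × ℝ. -/
noncomputable def pdx (f : ℝ × ℝ → ℝ) (p : ℝ × ℝ) : ℝ :=
  deriv (fun y => f (y, p.2)) p.1

/-- Partial derivative in the second (time) variable of a function on ℝ × ℝ. -/
noncomputable def pdt (f : ℝ × ℝ → ℝ) (p : ℝ × ℝ) : ℝ :=
  deriv (fun s => f (p.1, s)) p.2

lemma hx_aux {f : ℝ × ℝ → ℝ} (hf : ContDiff ℝ (⊤ : ℕ∞) f) (x t : ℝ) :
    HasDerivAt (fun y => f (y, t)) (fderiv ℝ f (x, t) (1, 0)) x := by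
  have h1 : HasFDerivAt f (fderiv ℝ f (x, t)) (x, t) :=
    (hf.differentiable (by simp) (x, t)).hasFDerivAt
  have h2 : HasDerivAt (fun y : ℝ => (y, t)) ((1 : ℝ), (0 : ℝ)) x :=
    (hasDerivAt_id x).prodMk (hasDerivAt_const x t)
  exact h1.comp_hasDerivAt x h2

lemma ht_aux {f : ℝ × ℝ → ℝ} (hf : ContDiff ℝ (⊤ : ℕ∞) f) (x t : ℝ) :
    HasDerivAt (fun s => f (x, s)) (fderiv ℝ f (x, t) (0, 1)) t := by
  have h1 : HasFDerivAt f (fderiv ℝ f (x, t)) (x, t) :=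
    (hf.differentiable (by simp) (x, t)).hasFDerivAt
  have h2 : HasDerivAt (fun y : ℝ => (x, y)) ((0 : ℝ), (1 : ℝ)) t :=
    (hasDerivAt_const t x).prodMk (hasDerivAt_id t)
  exact h1.comp_hasDerivAt t h2

lemma pdx_eq {f : ℝ × ℝ → ℝ} (hf : ContDiff ℝ (⊤ : ℕ∞) f) :
    pdx f = fun p => fderiv ℝ f p (1, 0) := by
  funext p
  exact (hx_aux hf p.1 p.2).deriv

lemma pdt_eq {f : ℝ × ℝ → ℝ} (hf : ContDiff ℝ (⊤ : ℕ∞) f) :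
    pdt f = fun p => fderiv ℝ f p (0, 1) := by
  funext p
  exact (ht_aux hf p.1 p.2).deriv

lemma fd_smooth {f : ℝ × ℝ → ℝ} (hf : ContDiff ℝ (⊤ : ℕ∞) f) :
    ContDiff ℝ (⊤ : ℕ∞) (fderiv ℝ f) :=
  hf.fderiv_right (by simp)

lemma pdx_smooth {f : ℝ × ℝ → ℝ} (hf : ContDiff ℝ (⊤ : ℕ∞) f) :
    ContDiff ℝ (⊤ : ℕ∞) (pdx f) := by
  rw [pdx_eq hf]
  exact (fd_smooth hf).clm_apply contDiff_const

lemma pdt_smooth {f : ℝ × ℝ → ℝ} (hf : ContDiff ℝ (⊤ : ℕ∞) f) :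
    ContDiff ℝ (⊤ : ℕ∞) (pdt f) := by
  rw [pdt_eq hf]
  exact (fd_smooth hf).clm_apply contDiff_const

lemma pdx_has {f : ℝ × ℝ → ℝ} (hf : ContDiff ℝ (⊤ : ℕ∞) f) (x t : ℝ) :
    HasDerivAt (fun y => f (y, t)) (pdx f (x, t)) x := by
  rw [pdx_eq hf]; exact hx_aux hf x t

lemma pdt_has {f : ℝ × ℝ → ℝ} (hf : ContDiff ℝ (⊤ : ℕ∞) f) (x t : ℝ) :
    HasDerivAt (fun s => f (x, s)) (pdt f (x, t)) t := by
  rw [pdt_eq hf]; exact ht_aux hf x t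

lemma pd_comm {f : ℝ × ℝ → ℝ} (hf : ContDiff ℝ (⊤ : ℕ∞) f) (p : ℝ × ℝ) :
    pdt (pdx f) p = pdx (pdt f) p := by
  rw [pdt_eq (pdx_smooth hf), pdx_eq (pdt_smooth hf), pdx_eq hf, pdt_eq hf]
  have hd : DifferentiableAt ℝ (fderiv ℝ f) p := (fd_smooth hf).differentiable (by simp) p
  have hs : IsSymmSndFDerivAt ℝ f p := hf.contDiffAt.isSymmSndFDerivAt (by simp only [minSmoothness_of_isRCLikeNormedField]; exact WithTop.coe_le_coe.mpr (le_top : (2 : ℕ∞) ≤ ⊤))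
  simp only
  rw [fderiv_clm_apply hd (by fun_prop), fderiv_clm_apply hd (by fun_prop)]
  simpa using hs (0, 1) (1, 0)

lemma pdx_per {f : ℝ × ℝ → ℝ} (h : ∀ x t : ℝ, f (x + 2 * π, t) = f (x, t)) (x t : ℝ) :
    pdx f (x + 2 * π, t) = pdx f (x, t) := by
  unfold pdx
  simp only
  rw [← deriv_comp_add_const]
  simp only [h]

lemma deriv_int {f : ℝ × ℝ → ℝ} (hf : ContDiff ℝ (⊤ : ℕ∞) f) (a b t : ℝ) :
    HasDerivAt (fun s => ∫ x in a..b, f (x, s)) (∫ x in a..b, pdt f (x, t)) t := by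
  have hc : Continuous f := hf.continuous
  have hc' : Continuous (pdt f) := (pdt_smooth hf).continuous
  obtain ⟨C, hC⟩ := (isCompact_uIcc (a := a) (b := b)).prod
    (isCompact_closedBall t 1) |>.exists_bound_of_continuousOn hc'.continuousOn
  refine (intervalIntegral.hasDerivAt_integral_of_dominated_loc_of_deriv_le
    (F := fun s x => f (x, s)) (F' := fun s x => pdt f (x, s)) (bound := fun _ => C)
    (Metric.ball_mem_nhds t one_pos) ?_ ?_ ?_ ?_ ?_ ?_).2
  · refine Filter.Eventually.of_forall fun s => ?_
    exact (by fun_prop : Continuous fun x => f (x, s)).aestronglyMeasurable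
  · exact (by fun_prop : Continuous fun x => f (x, t)).intervalIntegrable _ _
  · exact (by fun_prop : Continuous fun x => pdt f (x, t)).aestronglyMeasurable
  · refine Filter.Eventually.of_forall fun x hx s hs => ?_
    exact hC (x, s) ⟨Set.uIoc_subset_uIcc hx, Metric.ball_subset_closedBall hs⟩
  · exact intervalIntegrable_const
  · exact Filter.Eventually.of_forall fun x hx s hs => pdt_has hf x s

/-- The Ḣ¹ energy identity for the 1D chemotaxis system with classical diffusion:
(1/2) d/dt ∫((∂ₓu)² + (∂ₓq)²) dx = −∫(∂ₓₓu)² dx + (3/2)∫ ∂ₓq (∂ₓu)² dx. -/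
theorem energy_identity_H1
    (u q : ℝ × ℝ → ℝ) (hu : ContDiff ℝ (⊤ : ℕ∞) u) (hq : ContDiff ℝ (⊤ : ℕ∞) q)
    (hu_per : ∀ x t : ℝ, u (x + 2 * π, t) = u (x, t))
    (hq_per : ∀ x t : ℝ, q (x + 2 * π, t) = q (x, t))
    (heq_u : ∀ p : ℝ × ℝ, pdt u p = pdx (pdx u) p + pdx (fun r => u r * q r) p)
    (heq_q : ∀ p : ℝ × ℝ, pdt q p = u p * pdx u p) :
    ∀ t : ℝ,
      HasDerivAt
        (fun s => (1 / 2 : ℝ) *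
          ∫ x in (0:ℝ)..(2 * π), ((pdx u (x, s)) ^ 2 + (pdx q (x, s)) ^ 2))
        (-(∫ x in (0:ℝ)..(2 * π), (pdx (pdx u) (x, t)) ^ 2)
          + (3 / 2 : ℝ) * ∫ x in (0:ℝ)..(2 * π), pdx q (x, t) * (pdx u (x, t)) ^ 2) t := by
  intro t
  have hux := pdx_smooth hu
  have huxx := pdx_smooth hux
  have hqx := pdx_smooth hq
  have hE : ContDiff ℝ (⊤ : ℕ∞) (fun p => (pdx u p) ^ 2 + (pdx q p) ^ 2) :=
    (hux.pow 2).add (hqx.pow 2)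
  have hD := (deriv_int hE 0 (2 * π) t).const_mul (1 / 2 : ℝ)
  refine hD.congr_deriv ?_
  -- equations
  have huq : pdx (fun r => u r * q r) = fun p => pdx u p * q p + u p * pdx q p := by
    funext p
    exact ((pdx_has hu p.1 p.2).mul (pdx_has hq p.1 p.2)).deriv
  have e1 : ∀ x, pdt (pdx u) (x, t) = pdx (pdx (pdx u)) (x, t)
      + (pdx (pdx u) (x, t) * q (x, t) + pdx u (x, t) * pdx q (x, t)
        + (pdx u (x, t) * pdx q (x, t) + u (x, t) * pdx (pdx q) (x, t))) := by
    intro x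
    rw [pd_comm hu, funext heq_u, huq]
    exact ((pdx_has huxx x t).add (((pdx_has hux x t).mul (pdx_has hq x t)).add
      ((pdx_has hu x t).mul (pdx_has hqx x t)))).deriv
  have e2 : ∀ x, pdt (pdx q) (x, t) = pdx u (x, t) * pdx u (x, t)
      + u (x, t) * pdx (pdx u) (x, t) := by
    intro x
    rw [pd_comm hq, funext heq_q]
    exact ((pdx_has hu x t).mul (pdx_has hux x t)).deriv
  have e3 : ∀ x, pdt (fun p => (pdx u p) ^ 2 + (pdx q p) ^ 2) (x, t)
      = 2 * pdx u (x, t) * pdt (pdx u) (x, t) + 2 * pdx q (x, t) * pdt (pdx q) (x, t) := by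
    intro x
    have := (((pdt_has hux x t).pow 2).add ((pdt_has hqx x t).pow 2)).deriv
    refine Eq.trans this ?_
    push_cast
    ring
  have c0 := hu.continuous
  have c1 := hux.continuous
  have c2 := huxx.continuous
  have c3 := (pdx_smooth huxx).continuous
  have d0 := hq.continuous
  have d1 := hqx.continuous
  have d2 := (pdx_smooth hqx).continuous
  have cE := (pdt_smooth hE).continuous
  -- the total derivative
  have hG := integral_eq_sub_of_hasDerivAt (a := 0) (b := 2 * π)
    (f := fun x => pdx u (x, t) * pdx (pdx u) (x, t)
      + (1 / 2 : ℝ) * (q (x, t) * (pdx u (x, t) * pdx u (x, t)))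
      + u (x, t) * (pdx u (x, t) * pdx q (x, t)))
    (fun x _ => (((pdx_has hux x t).mul (pdx_has huxx x t)).add
      (((pdx_has hq x t).mul ((pdx_has hux x t).mul (pdx_has hux x t))).const_mul (1 / 2 : ℝ))).add
      ((pdx_has hu x t).mul ((pdx_has hux x t).mul (pdx_has hqx x t))))
    (Continuous.intervalIntegrable (by fun_prop) _ _)
  have p1 := pdx_per hu_per 0 t
  have p2 := pdx_per (pdx_per hu_per) 0 t
  have p3 := pdx_per hq_per 0 t
  have p4 := hu_per 0 t
  have p5 := hq_per 0 t
  rw [zero_add] at p1 p2 p3 p4 p5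
  simp only [p1, p2, p3, p4, p5, sub_self] at hG
  rw [← sub_eq_zero, ← integral_neg, ← integral_const_mul, ← integral_const_mul,
    ← integral_add, ← integral_sub]
  · refine Eq.trans ?_ hG
    apply intervalIntegral.integral_congr
    intro x _
    simp only [e3, e1, e2, Pi.mul_apply]
    ring
  all_goals exact Continuous.intervalIntegrable (by fun_prop) _ _
end

section
/- Let c > 0 and let E : ℝ → ℝ be differentiable and nonnegative on [0,∞) and D : ℝ → ℝ be continuous and nonnegative on [0,∞), satisfying E'(t) + D(t) ≤ c·√(E(t))·D(t) for all t ≥ 0. If c·√(E(0)) < 1, then E(t) ≤ E(0) for all t ≥ 0, and moreover ∫₀^t D(s) ds ≤ E(0)/(1 − c·√(E(0))) for all t ≥ 0. -/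
open Set

/-- Differential-inequality bootstrap for small data: if E' + D ≤ c √E D on [0,∞)
with E differentiable and nonnegative, D continuous and nonnegative, and
c √(E 0) < 1, then E stays below E 0 and the dissipation integral is bounded
by E 0 / (1 − c √(E 0)). -/
theorem small_data_bootstrap
    (c : ℝ) (hc : 0 < c) (E D : ℝ → ℝ)
    (hE_diff : ∀ t ∈ Ici (0:ℝ), DifferentiableAt ℝ E t)
    (hE_nonneg : ∀ t ∈ Ici (0:ℝ), 0 ≤ E t)
    (hD_cont : ContinuousOn D (Ici (0:ℝ)))
    (hD_nonneg : ∀ t ∈ Ici (0:ℝ), 0 ≤ D t)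
    (hineq : ∀ t ∈ Ici (0:ℝ), deriv E t + D t ≤ c * Real.sqrt (E t) * D t)
    (hsmall : c * Real.sqrt (E 0) < 1) :
    (∀ t ∈ Ici (0:ℝ), E t ≤ E 0) ∧
    (∀ t ∈ Ici (0:ℝ), (∫ s in (0:ℝ)..t, D s) ≤ E 0 / (1 - c * Real.sqrt (E 0))) := by
  have hcontE : ∀ T : ℝ, ContinuousOn E (Icc 0 T) := fun T x hx =>
    (hE_diff x hx.1).continuousAt.continuousWithinAt
  have h1 : ∀ t ∈ Ici (0:ℝ), E t ≤ E 0 := by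
    intro T hT
    have hT0 : (0:ℝ) ≤ T := hT
    have hlim : Filter.Tendsto (fun ε : ℝ => E 0 + ε * T) (nhdsWithin 0 (Ioi 0)) (nhds (E 0)) := by
      have : Continuous (fun ε : ℝ => E 0 + ε * T) := by fun_prop
      have h := (this.tendsto 0).mono_left (nhdsWithin_le_nhds (s := Ioi (0:ℝ)))
      simpa using h
    have hev : ∀ᶠ ε in nhdsWithin (0:ℝ) (Ioi 0), c * Real.sqrt (E 0 + ε * T) < 1 :=
      ((Real.continuous_sqrt.tendsto _).comp hlim |>.const_mul c).eventually
        (gt_mem_nhds hsmall)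
    refine ge_of_tendsto hlim ?_
    filter_upwards [hev, self_mem_nhdsWithin] with ε hε hpos
    have hpos' : (0:ℝ) < ε := hpos
    refine image_le_of_deriv_right_lt_deriv_boundary (f := E) (f' := deriv E) (a := 0) (b := T)
      (B := fun x => E 0 + ε * x) (B' := fun _ => ε) (hcontE T)
      (fun x hx => (hE_diff x hx.1).hasDerivAt.hasDerivWithinAt) (by simp)
      (fun x => by simpa using ((hasDerivAt_id x).const_mul ε).const_add (E 0)) ?_
      (right_mem_Icc.2 hT0)
    intro x hx heq
    have hle : c * Real.sqrt (E x) ≤ c * Real.sqrt (E 0 + ε * T) := by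
      rw [heq]
      have := hx.2.le
      gcongr
    have hd := hD_nonneg x hx.1
    have hi := hineq x hx.1
    nlinarith [mul_nonneg (sub_nonneg.2 (hle.trans hε.le)) hd]
  refine ⟨h1, fun t ht => ?_⟩
  have ht0 : (0:ℝ) ≤ t := ht
  have hk : 0 < 1 - c * Real.sqrt (E 0) := by linarith
  rw [le_div_iff₀ hk, mul_comm, ← intervalIntegral.integral_const_mul]
  have h2 := intervalIntegral.integral_le_sub_of_hasDeriv_right_of_le (g := fun x => - E x)
    (g' := fun x => - deriv E x) (φ := fun x => (1 - c * Real.sqrt (E 0)) * D x) ht0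
    (hcontE t).neg
    (fun x hx => (hE_diff x hx.1.le).hasDerivAt.neg.hasDerivWithinAt)
    ((continuousOn_const.mul (hD_cont.mono Icc_subset_Ici_self)).integrableOn_Icc) (by
      intro x hx
      have hx0 : x ∈ Ici (0:ℝ) := hx.1.le
      have hd := hD_nonneg x hx0
      have hi := hineq x hx0
      have hle : c * Real.sqrt (E x) ≤ c * Real.sqrt (E 0) := by
        have := h1 x hx0
        gcongr
      have := mul_le_mul_of_nonneg_right hle hd
      linarith)
  have := hE_nonneg t ht
  linarith
end
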